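/- For each guarded recursive specification E over ACP and each variable X occurring in E, there exists a finite or countably infinite linear recursive specification E' over ACP such that the equation ⟨X|E⟩ = ⟨X|E'⟩ is derivable from the axioms of ACPrec in infinitary conditional equational logic. -/

import Mathlib

namespace ACPNote

/-! ### ACP terms

We fix a set `Act` of actions.  The inaction constant δ is not in `Act`; the set
`Act ∪ {δ}` of constants is represented by `Option Act`, with `none` playing the
role of δ.  The countably infinite set of variables is represented by `ℕ`. -/

/-- Terms over the signature of ACP, with action constants from `Act`,
the inaction constant δ, variables from `ℕ`, alternative composition `alt`,
sequential composition `seq`, parallel composition `par`, left merge `lm`,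
communication merge `cm`, and encapsulation operators `encap H` for `H ⊆ Act`. -/
inductive ACPTerm (Act : Type) : Type
  | act : Act → ACPTerm Act
  | delta : ACPTerm Act
  | var : ℕ → ACPTerm Act
  | alt : ACPTerm Act → ACPTerm Act → ACPTerm Act
  | seq : ACPTerm Act → ACPTerm Act → ACPTerm Act
  | par : ACPTerm Act → ACPTerm Act → ACPTerm Act
  | lm : ACPTerm Act → ACPTerm Act → ACPTerm Act
  | cm : ACPTerm Act → ACPTerm Act → ACPTerm Act
  | encap : Set Act → ACPTerm Act → ACPTerm Act

/-- The ACP constant corresponding to an element of `Act ∪ {δ}`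
(`none` is δ, `some a` is the action constant `a`). -/
def ACPTerm.ofConst {Act : Type} : Option Act → ACPTerm Act
  | none => .delta
  | some a => .act a

/-- Derivability of equations between ACP terms from the axioms of ACP
(A1–A7, CM1–CM9, CF, D1–D4) in equational logic: the axioms are stated as
schemas (i.e. closed under substitution) and derivability is closed under
reflexivity, symmetry, transitivity and congruence for all operators.
The communication function `γ` on `Act ∪ {δ}` interprets the communication
merge on constants (axiom CF). -/
inductive ACPDeriv {Act : Type} (γ : Option Act → Option Act → Option Act) :
    ACPTerm Act → ACPTerm Act → Prop
  | refl (t) : ACPDeriv γ t t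
  | symm {t s} : ACPDeriv γ t s → ACPDeriv γ s t
  | trans {t s u} : ACPDeriv γ t s → ACPDeriv γ s u → ACPDeriv γ t u
  | altCongr {t t' s s'} : ACPDeriv γ t t' → ACPDeriv γ s s' →
      ACPDeriv γ (.alt t s) (.alt t' s')
  | seqCongr {t t' s s'} : ACPDeriv γ t t' → ACPDeriv γ s s' →
      ACPDeriv γ (.seq t s) (.seq t' s')
  | parCongr {t t' s s'} : ACPDeriv γ t t' → ACPDeriv γ s s' →
      ACPDeriv γ (.par t s) (.par t' s')
  | lmCongr {t t' s s'} : ACPDeriv γ t t' → ACPDeriv γ s s' →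
      ACPDeriv γ (.lm t s) (.lm t' s')
  | cmCongr {t t' s s'} : ACPDeriv γ t t' → ACPDeriv γ s s' →
      ACPDeriv γ (.cm t s) (.cm t' s')
  | encapCongr (H : Set Act) {t t'} : ACPDeriv γ t t' →
      ACPDeriv γ (.encap H t) (.encap H t')
  | A1 (x y) : ACPDeriv γ (.alt x y) (.alt y x)
  | A2 (x y z) : ACPDeriv γ (.alt (.alt x y) z) (.alt x (.alt y z))
  | A3 (x) : ACPDeriv γ (.alt x x) x
  | A4 (x y z) : ACPDeriv γ (.seq (.alt x y) z) (.alt (.seq x z) (.seq y z))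
  | A5 (x y z) : ACPDeriv γ (.seq (.seq x y) z) (.seq x (.seq y z))
  | A6 (x) : ACPDeriv γ (.alt x .delta) x
  | A7 (x) : ACPDeriv γ (.seq .delta x) .delta
  | CM1 (x y) : ACPDeriv γ (.par x y) (.alt (.alt (.lm x y) (.lm y x)) (.cm x y))
  | CM2 (a : Option Act) (x) :
      ACPDeriv γ (.lm (.ofConst a) x) (.seq (.ofConst a) x)
  | CM3 (a : Option Act) (x y) :
      ACPDeriv γ (.lm (.seq (.ofConst a) x) y) (.seq (.ofConst a) (.par x y))
  | CM4 (x y z) : ACPDeriv γ (.lm (.alt x y) z) (.alt (.lm x z) (.lm y z))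
  | CM5 (a b : Option Act) (x) :
      ACPDeriv γ (.cm (.seq (.ofConst a) x) (.ofConst b))
        (.seq (.cm (.ofConst a) (.ofConst b)) x)
  | CM6 (a b : Option Act) (x) :
      ACPDeriv γ (.cm (.ofConst a) (.seq (.ofConst b) x))
        (.seq (.cm (.ofConst a) (.ofConst b)) x)
  | CM7 (a b : Option Act) (x y) :
      ACPDeriv γ (.cm (.seq (.ofConst a) x) (.seq (.ofConst b) y))
        (.seq (.cm (.ofConst a) (.ofConst b)) (.par x y))
  | CM8 (x y z) : ACPDeriv γ (.cm (.alt x y) z) (.alt (.cm x z) (.cm y z))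
  | CM9 (x y z) : ACPDeriv γ (.cm x (.alt y z)) (.alt (.cm x y) (.cm x z))
  | CF (a b : Option Act) :
      ACPDeriv γ (.cm (.ofConst a) (.ofConst b)) (.ofConst (γ a b))
  | D1 (a : Option Act) (H : Set Act) (h : ∀ b, a = some b → b ∉ H) :
      ACPDeriv γ (.encap H (.ofConst a)) (.ofConst a)
  | D2 (a : Act) (H : Set Act) (h : a ∈ H) :
      ACPDeriv γ (.encap H (.act a)) .delta
  | D3 (H : Set Act) (x y) :
      ACPDeriv γ (.encap H (.alt x y)) (.alt (.encap H x) (.encap H y))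
  | D4 (H : Set Act) (x y) :
      ACPDeriv γ (.encap H (.seq x y)) (.seq (.encap H x) (.encap H y))

/-- A term is guarded when every occurrence of a variable in it occurs within a
subterm of the form `a · t'` with `a ∈ Act`. -/
def ACPTerm.Guarded {Act : Type} : ACPTerm Act → Prop
  | .act _ => True
  | .delta => True
  | .var _ => False
  | .alt t s => t.Guarded ∧ s.Guarded
  | .seq t s => (∃ a : Act, t = .act a) ∨ (t.Guarded ∧ s.Guarded)
  | .par t s => t.Guarded ∧ s.Guarded
  | .lm t s => t.Guarded ∧ s.Guarded
  | .cm t s => t.Guarded ∧ s.Guarded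
  | .encap _ t => t.Guarded

/-- Head normal forms of ACP: δ, action constants `a`, terms `a · t`
with `a ∈ Act`, and alternative compositions of head normal forms. -/
inductive ACPTerm.HNF {Act : Type} : ACPTerm Act → Prop
  | delta : HNF .delta
  | act (a : Act) : HNF (.act a)
  | seqAct (a : Act) (t : ACPTerm Act) : HNF (.seq (.act a) t)
  | alt {t t'} : HNF t → HNF t' → HNF (.alt t t')

/-- Linear ACP terms: δ, action constants `a`, terms `a · X` with `a ∈ Act`
and `X` a variable, and alternative compositions of linear terms. -/
inductive ACPTerm.Linear {Act : Type} : ACPTerm Act → Prop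
  | delta : Linear .delta
  | act (a : Act) : Linear (.act a)
  | seqVar (a : Act) (X : ℕ) : Linear (.seq (.act a) (.var X))
  | alt {t t'} : Linear t → Linear t' → Linear (.alt t t')

/-- The generalized sum `Σ_{i<n} tᵢ`: the empty sum is δ, a sum of one summand
is that summand, and `Σ_{i<n+1} tᵢ = (Σ_{i<n} tᵢ) + tₙ`. -/
def bigAlt {Act : Type} : (n : ℕ) → (Fin n → ACPTerm Act) → ACPTerm Act
  | 0, _ => .delta
  | 1, f => f 0
  | n + 2, f => .alt (bigAlt (n + 1) fun i => f i.castSucc) (f (Fin.last (n + 1)))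

/-- The set of variables occurring in an ACP term. -/
def ACPTerm.varsOf {Act : Type} : ACPTerm Act → Set ℕ
  | .act _ => ∅
  | .delta => ∅
  | .var X => {X}
  | .alt t s => t.varsOf ∪ s.varsOf
  | .seq t s => t.varsOf ∪ s.varsOf
  | .par t s => t.varsOf ∪ s.varsOf
  | .lm t s => t.varsOf ∪ s.varsOf
  | .cm t s => t.varsOf ∪ s.varsOf
  | .encap _ t => t.varsOf

/-! ### Guarded recursive specifications and ACPrec -/

/-- Rewriting of ACP terms using the axioms of ACP in either direction and/or
the equations `X_j = t_j` (for `j ∈ dom`, `j ≠ i`) of a recursive specification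
from left to right; it is reflexive, transitive and compatible with all
operators, but the specification equations may only be used left-to-right. -/
inductive Rewrites {Act : Type} (γ : Option Act → Option Act → Option Act)
    (rhs : ℕ → ACPTerm Act) (dom : Set ℕ) (i : ℕ) :
    ACPTerm Act → ACPTerm Act → Prop
  | acp {t s} : ACPDeriv γ t s → Rewrites γ rhs dom i t s
  | unfold {j} (h : j ∈ dom) (hne : j ≠ i) : Rewrites γ rhs dom i (.var j) (rhs j)
  | trans {t s u} : Rewrites γ rhs dom i t s → Rewrites γ rhs dom i s u →
      Rewrites γ rhs dom i t u
  | altCongr {t t' s s'} : Rewrites γ rhs dom i t t' → Rewrites γ rhs dom i s s' →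
      Rewrites γ rhs dom i (.alt t s) (.alt t' s')
  | seqCongr {t t' s s'} : Rewrites γ rhs dom i t t' → Rewrites γ rhs dom i s s' →
      Rewrites γ rhs dom i (.seq t s) (.seq t' s')
  | parCongr {t t' s s'} : Rewrites γ rhs dom i t t' → Rewrites γ rhs dom i s s' →
      Rewrites γ rhs dom i (.par t s) (.par t' s')
  | lmCongr {t t' s s'} : Rewrites γ rhs dom i t t' → Rewrites γ rhs dom i s s' →
      Rewrites γ rhs dom i (.lm t s) (.lm t' s')
  | cmCongr {t t' s s'} : Rewrites γ rhs dom i t t' → Rewrites γ rhs dom i s s' →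
      Rewrites γ rhs dom i (.cm t s) (.cm t' s')
  | encapCongr (H : Set Act) {t t'} : Rewrites γ rhs dom i t t' →
      Rewrites γ rhs dom i (.encap H t) (.encap H t')

/-- A guarded recursive specification over ACP: a set of recursion equations
`X = rhs X` for `X ∈ dom` (with pairwise distinct left-hand side variables,
which our functional representation enforces), such that each right-hand side
is a guarded ACP term in which only variables from `dom` occur, or is
rewritable to such a term using the ACP axioms in either direction and/or the
other equations of the specification from left to right. -/
structure GRS (Act : Type) (γ : Option Act → Option Act → Option Act) : Type where
  dom : Set ℕ
  rhs : ℕ → ACPTerm Act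
  guarded : ∀ i ∈ dom, ∃ t', Rewrites γ rhs dom i (rhs i) t' ∧
      t'.Guarded ∧ t'.varsOf ⊆ dom

/-- A linear recursive specification: a guarded recursive specification whose
right-hand sides are all linear ACP terms. -/
def GRS.Linear {Act : Type} {γ : Option Act → Option Act → Option Act}
    (E : GRS Act γ) : Prop :=
  ∀ i ∈ E.dom, (E.rhs i).Linear

/-- Terms over the signature of ACPrec: the signature of ACP extended with a
constant `rec X E` (written ⟨X|E⟩) for each guarded recursive specification
`E` over ACP and each variable `X` of `E`. -/
inductive ACPrTerm (Act : Type) (γ : Option Act → Option Act → Option Act) : Type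
  | act : Act → ACPrTerm Act γ
  | delta : ACPrTerm Act γ
  | var : ℕ → ACPrTerm Act γ
  | recur : ℕ → GRS Act γ → ACPrTerm Act γ
  | alt : ACPrTerm Act γ → ACPrTerm Act γ → ACPrTerm Act γ
  | seq : ACPrTerm Act γ → ACPrTerm Act γ → ACPrTerm Act γ
  | par : ACPrTerm Act γ → ACPrTerm Act γ → ACPrTerm Act γ
  | lm : ACPrTerm Act γ → ACPrTerm Act γ → ACPrTerm Act γ
  | cm : ACPrTerm Act γ → ACPrTerm Act γ → ACPrTerm Act γ
  | encap : Set Act → ACPrTerm Act γ → ACPrTerm Act γ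

/-- The ACPrec constant corresponding to an element of `Act ∪ {δ}`. -/
def ACPrTerm.ofConst {Act : Type} {γ : Option Act → Option Act → Option Act} :
    Option Act → ACPrTerm Act γ
  | none => .delta
  | some a => .act a

/-- The embedding of ACP terms into ACPrec terms. -/
def ACPTerm.toACPr {Act : Type} (γ : Option Act → Option Act → Option Act) :
    ACPTerm Act → ACPrTerm Act γ
  | .act a => .act a
  | .delta => .delta
  | .var X => .var X
  | .alt t s => .alt (t.toACPr γ) (s.toACPr γ)
  | .seq t s => .seq (t.toACPr γ) (s.toACPr γ)
  | .par t s => .par (t.toACPr γ) (s.toACPr γ)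
  | .lm t s => .lm (t.toACPr γ) (s.toACPr γ)
  | .cm t s => .cm (t.toACPr γ) (s.toACPr γ)
  | .encap H t => .encap H (t.toACPr γ)

open Classical in
/-- `⟨t|E⟩`: the ACPrec term obtained from the ACP term `t` by replacing every
occurrence of a variable `X` of `E` by the constant `⟨X|E⟩`. -/
noncomputable def GRS.sub {Act : Type} {γ : Option Act → Option Act → Option Act}
    (E : GRS Act γ) : ACPTerm Act → ACPrTerm Act γ
  | .act a => .act a
  | .delta => .delta
  | .var X => if X ∈ E.dom then .recur X E else .var X
  | .alt t s => .alt (E.sub t) (E.sub s)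
  | .seq t s => .seq (E.sub t) (E.sub s)
  | .par t s => .par (E.sub t) (E.sub s)
  | .lm t s => .lm (E.sub t) (E.sub s)
  | .cm t s => .cm (E.sub t) (E.sub s)
  | .encap H t => .encap H (E.sub t)

/-- Substitution of ACPrec terms for variables in an ACPrec term. -/
def ACPrTerm.subst {Act : Type} {γ : Option Act → Option Act → Option Act}
    (σ : ℕ → ACPrTerm Act γ) : ACPrTerm Act γ → ACPrTerm Act γ
  | .act a => .act a
  | .delta => .delta
  | .var X => σ X
  | .recur X E => .recur X E
  | .alt t s => .alt (t.subst σ) (s.subst σ)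
  | .seq t s => .seq (t.subst σ) (s.subst σ)
  | .par t s => .par (t.subst σ) (s.subst σ)
  | .lm t s => .lm (t.subst σ) (s.subst σ)
  | .cm t s => .cm (t.subst σ) (s.subst σ)
  | .encap H t => .encap H (t.subst σ)

/-- Guardedness for ACPrec terms: every occurrence of a variable occurs within
a subterm of the form `a · t'` with `a ∈ Act`. -/
def ACPrTerm.Guarded {Act : Type} {γ : Option Act → Option Act → Option Act} :
    ACPrTerm Act γ → Prop
  | .act _ => True
  | .delta => True
  | .var _ => False
  | .recur _ _ => True
  | .alt t s => t.Guarded ∧ s.Guarded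
  | .seq t s => (∃ a : Act, t = .act a) ∨ (t.Guarded ∧ s.Guarded)
  | .par t s => t.Guarded ∧ s.Guarded
  | .lm t s => t.Guarded ∧ s.Guarded
  | .cm t s => t.Guarded ∧ s.Guarded
  | .encap _ t => t.Guarded

/-- Closed ACPrec terms: terms in which no variable occurs. -/
def ACPrTerm.Closed {Act : Type} {γ : Option Act → Option Act → Option Act} :
    ACPrTerm Act γ → Prop
  | .act _ => True
  | .delta => True
  | .var _ => False
  | .recur _ _ => True
  | .alt t s => t.Closed ∧ s.Closed
  | .seq t s => t.Closed ∧ s.Closed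
  | .par t s => t.Closed ∧ s.Closed
  | .lm t s => t.Closed ∧ s.Closed
  | .cm t s => t.Closed ∧ s.Closed
  | .encap _ t => t.Closed

/-- Head normal forms of ACPrec. -/
inductive ACPrTerm.HNF {Act : Type} {γ : Option Act → Option Act → Option Act} :
    ACPrTerm Act γ → Prop
  | delta : HNF .delta
  | act (a : Act) : HNF (.act a)
  | seqAct (a : Act) (t : ACPrTerm Act γ) : HNF (.seq (.act a) t)
  | alt {t t'} : HNF t → HNF t' → HNF (.alt t t')

/-- Derivability of equations between ACPrec terms from the axioms of ACPrec
(the axioms of ACP together with RDP and RSP) in infinitary conditional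
equational logic: the axioms are stated as schemas, derivability is closed
under reflexivity, symmetry, transitivity and congruence, and the rule RSP may
have infinitely many premises (one for each equation of the specification),
instantiated by an arbitrary substitution `σ`. -/
inductive ACPrDeriv {Act : Type} (γ : Option Act → Option Act → Option Act) :
    ACPrTerm Act γ → ACPrTerm Act γ → Prop
  | refl (t) : ACPrDeriv γ t t
  | symm {t s} : ACPrDeriv γ t s → ACPrDeriv γ s t
  | trans {t s u} : ACPrDeriv γ t s → ACPrDeriv γ s u → ACPrDeriv γ t u
  | altCongr {t t' s s'} : ACPrDeriv γ t t' → ACPrDeriv γ s s' →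
      ACPrDeriv γ (.alt t s) (.alt t' s')
  | seqCongr {t t' s s'} : ACPrDeriv γ t t' → ACPrDeriv γ s s' →
      ACPrDeriv γ (.seq t s) (.seq t' s')
  | parCongr {t t' s s'} : ACPrDeriv γ t t' → ACPrDeriv γ s s' →
      ACPrDeriv γ (.par t s) (.par t' s')
  | lmCongr {t t' s s'} : ACPrDeriv γ t t' → ACPrDeriv γ s s' →
      ACPrDeriv γ (.lm t s) (.lm t' s')
  | cmCongr {t t' s s'} : ACPrDeriv γ t t' → ACPrDeriv γ s s' →
      ACPrDeriv γ (.cm t s) (.cm t' s')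
  | encapCongr (H : Set Act) {t t'} : ACPrDeriv γ t t' →
      ACPrDeriv γ (.encap H t) (.encap H t')
  | A1 (x y) : ACPrDeriv γ (.alt x y) (.alt y x)
  | A2 (x y z) : ACPrDeriv γ (.alt (.alt x y) z) (.alt x (.alt y z))
  | A3 (x) : ACPrDeriv γ (.alt x x) x
  | A4 (x y z) : ACPrDeriv γ (.seq (.alt x y) z) (.alt (.seq x z) (.seq y z))
  | A5 (x y z) : ACPrDeriv γ (.seq (.seq x y) z) (.seq x (.seq y z))
  | A6 (x) : ACPrDeriv γ (.alt x .delta) x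
  | A7 (x) : ACPrDeriv γ (.seq .delta x) .delta
  | CM1 (x y) : ACPrDeriv γ (.par x y) (.alt (.alt (.lm x y) (.lm y x)) (.cm x y))
  | CM2 (a : Option Act) (x) :
      ACPrDeriv γ (.lm (.ofConst a) x) (.seq (.ofConst a) x)
  | CM3 (a : Option Act) (x y) :
      ACPrDeriv γ (.lm (.seq (.ofConst a) x) y) (.seq (.ofConst a) (.par x y))
  | CM4 (x y z) : ACPrDeriv γ (.lm (.alt x y) z) (.alt (.lm x z) (.lm y z))
  | CM5 (a b : Option Act) (x) :
      ACPrDeriv γ (.cm (.seq (.ofConst a) x) (.ofConst b))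
        (.seq (.cm (.ofConst a) (.ofConst b)) x)
  | CM6 (a b : Option Act) (x) :
      ACPrDeriv γ (.cm (.ofConst a) (.seq (.ofConst b) x))
        (.seq (.cm (.ofConst a) (.ofConst b)) x)
  | CM7 (a b : Option Act) (x y) :
      ACPrDeriv γ (.cm (.seq (.ofConst a) x) (.seq (.ofConst b) y))
        (.seq (.cm (.ofConst a) (.ofConst b)) (.par x y))
  | CM8 (x y z) : ACPrDeriv γ (.cm (.alt x y) z) (.alt (.cm x z) (.cm y z))
  | CM9 (x y z) : ACPrDeriv γ (.cm x (.alt y z)) (.alt (.cm x y) (.cm x z))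
  | CF (a b : Option Act) :
      ACPrDeriv γ (.cm (.ofConst a) (.ofConst b)) (.ofConst (γ a b))
  | D1 (a : Option Act) (H : Set Act) (h : ∀ b, a = some b → b ∉ H) :
      ACPrDeriv γ (.encap H (.ofConst a)) (.ofConst a)
  | D2 (a : Act) (H : Set Act) (h : a ∈ H) :
      ACPrDeriv γ (.encap H (.act a)) .delta
  | D3 (H : Set Act) (x y) :
      ACPrDeriv γ (.encap H (.alt x y)) (.alt (.encap H x) (.encap H y))
  | D4 (H : Set Act) (x y) :
      ACPrDeriv γ (.encap H (.seq x y)) (.seq (.encap H x) (.encap H y))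
  | RDP (E : GRS Act γ) (X : ℕ) (h : X ∈ E.dom) :
      ACPrDeriv γ (.recur X E) (E.sub (E.rhs X))
  | RSP (E : GRS Act γ) (σ : ℕ → ACPrTerm Act γ)
      (h : ∀ X ∈ E.dom, ACPrDeriv γ (σ X) (((E.rhs X).toACPr γ).subst σ))
      (X : ℕ) (hX : X ∈ E.dom) :
      ACPrDeriv γ (σ X) (.recur X E)

/-! ### Structural operational semantics of ACPrec -/

mutual
  /-- The transition relation `t —a→ t'` of the structural operational
  semantics of ACPrec. -/
  inductive Step {Act : Type} (γ : Option Act → Option Act → Option Act) :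
      ACPrTerm Act γ → Act → ACPrTerm Act γ → Prop
    | altL {x a x'} (y) : Step γ x a x' → Step γ (.alt x y) a x'
    | altR {y a y'} (x) : Step γ y a y' → Step γ (.alt x y) a y'
    | seqTick {x a} (y) : Tick γ x a → Step γ (.seq x y) a y
    | seqStep {x a x'} (y) : Step γ x a x' → Step γ (.seq x y) a (.seq x' y)
    | parTickL {x a} (y) : Tick γ x a → Step γ (.par x y) a y
    | parTickR {y a} (x) : Tick γ y a → Step γ (.par x y) a x
    | parStepL {x a x'} (y) : Step γ x a x' → Step γ (.par x y) a (.par x' y)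
    | parStepR {y a y'} (x) : Step γ y a y' → Step γ (.par x y) a (.par x y')
    | parComm1 {x a y b y' c} : Tick γ x a → Step γ y b y' →
        γ (some a) (some b) = some c → Step γ (.par x y) c y'
    | parComm2 {x a x' y b c} : Step γ x a x' → Tick γ y b →
        γ (some a) (some b) = some c → Step γ (.par x y) c x'
    | parComm3 {x a x' y b y' c} : Step γ x a x' → Step γ y b y' →
        γ (some a) (some b) = some c → Step γ (.par x y) c (.par x' y')
    | lmTick {x a} (y) : Tick γ x a → Step γ (.lm x y) a y
    | lmStep {x a x'} (y) : Step γ x a x' → Step γ (.lm x y) a (.par x' y)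
    | cmComm1 {x a y b y' c} : Tick γ x a → Step γ y b y' →
        γ (some a) (some b) = some c → Step γ (.cm x y) c y'
    | cmComm2 {x a x' y b c} : Step γ x a x' → Tick γ y b →
        γ (some a) (some b) = some c → Step γ (.cm x y) c x'
    | cmComm3 {x a x' y b y' c} : Step γ x a x' → Step γ y b y' →
        γ (some a) (some b) = some c → Step γ (.cm x y) c (.par x' y')
    | encapStep {x a x'} (H : Set Act) : Step γ x a x' → a ∉ H →
        Step γ (.encap H x) a (.encap H x')
    | recStep {E : GRS Act γ} {X a s} : X ∈ E.dom →
        Step γ (E.sub (E.rhs X)) a s → Step γ (.recur X E) a s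

  /-- The successful-termination relation `t —a→ √` of the structural
  operational semantics of ACPrec. -/
  inductive Tick {Act : Type} (γ : Option Act → Option Act → Option Act) :
      ACPrTerm Act γ → Act → Prop
    | act (a : Act) : Tick γ (.act a) a
    | altL {x a} (y) : Tick γ x a → Tick γ (.alt x y) a
    | altR {y a} (x) : Tick γ y a → Tick γ (.alt x y) a
    | parComm {x a y b c} : Tick γ x a → Tick γ y b →
        γ (some a) (some b) = some c → Tick γ (.par x y) c
    | cmComm {x a y b c} : Tick γ x a → Tick γ y b →
        γ (some a) (some b) = some c → Tick γ (.cm x y) c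
    | encapTick {x a} (H : Set Act) : Tick γ x a → a ∉ H →
        Tick γ (.encap H x) a
    | recTick {E : GRS Act γ} {X a} : X ∈ E.dom →
        Tick γ (E.sub (E.rhs X)) a → Tick γ (.recur X E) a
end

/-- A bisimulation: a binary relation `R` on closed ACPrec terms such that for
all `R`-related `t₁, t₂`, every transition of `t₁` is matched by a transition
of `t₂` with the same action to `R`-related terms and vice versa, and `t₁` can
terminate successfully by performing `a` iff `t₂` can. -/
def IsBisimulation {Act : Type} (γ : Option Act → Option Act → Option Act)
    (R : ACPrTerm Act γ → ACPrTerm Act γ → Prop) : Prop :=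
  ∀ ⦃t₁ t₂⦄, R t₁ t₂ →
    t₁.Closed ∧ t₂.Closed ∧
    (∀ a t₁', Step γ t₁ a t₁' → ∃ t₂', Step γ t₂ a t₂' ∧ R t₁' t₂') ∧
    (∀ a t₂', Step γ t₂ a t₂' → ∃ t₁', Step γ t₁ a t₁' ∧ R t₁' t₂') ∧
    (∀ a, Tick γ t₁ a ↔ Tick γ t₂ a)

/-- Bisimulation equivalence of (closed) ACPrec terms. -/
def Bisim {Act : Type} (γ : Option Act → Option Act → Option Act)
    (t₁ t₂ : ACPrTerm Act γ) : Prop :=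
  ∃ R, IsBisimulation γ R ∧ R t₁ t₂


/-! ### Lifting derivations from ACP to ACPrec -/

section Lifting

variable {Act : Type} {γ : Option Act → Option Act → Option Act}

@[simp]
theorem GRS.sub_ofConst (E : GRS Act γ) (a : Option Act) :
    E.sub (.ofConst a) = .ofConst a := by
  cases a <;> rfl

theorem ACPDeriv.sub (E : GRS Act γ) {t s : ACPTerm Act} (h : ACPDeriv γ t s) :
    ACPrDeriv γ (E.sub t) (E.sub s) := by
  induction h with
  | refl t => exact .refl _
  | symm _ ih => exact .symm ih
  | trans _ _ ih₁ ih₂ => exact .trans ih₁ ih₂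
  | altCongr _ _ ih₁ ih₂ => exact .altCongr ih₁ ih₂
  | seqCongr _ _ ih₁ ih₂ => exact .seqCongr ih₁ ih₂
  | parCongr _ _ ih₁ ih₂ => exact .parCongr ih₁ ih₂
  | lmCongr _ _ ih₁ ih₂ => exact .lmCongr ih₁ ih₂
  | cmCongr _ _ ih₁ ih₂ => exact .cmCongr ih₁ ih₂
  | encapCongr H _ ih => exact .encapCongr H ih
  | A1 x y => exact .A1 _ _
  | A2 x y z => exact .A2 _ _ _
  | A3 x => exact .A3 _
  | A4 x y z => exact .A4 _ _ _
  | A5 x y z => exact .A5 _ _ _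
  | A6 x => exact .A6 _
  | A7 x => exact .A7 _
  | CM1 x y => exact .CM1 _ _
  | CM4 x y z => exact .CM4 _ _ _
  | CM8 x y z => exact .CM8 _ _ _
  | CM9 x y z => exact .CM9 _ _ _
  | D2 a H h => exact .D2 a H h
  | D3 H x y => exact .D3 H _ _
  | D4 H x y => exact .D4 H _ _
  | CM2 a x => simpa only [GRS.sub, GRS.sub_ofConst] using .CM2 a _
  | CM3 a x y => simpa only [GRS.sub, GRS.sub_ofConst] using .CM3 a _ _
  | CM5 a b x => simpa only [GRS.sub, GRS.sub_ofConst] using .CM5 a b _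
  | CM6 a b x => simpa only [GRS.sub, GRS.sub_ofConst] using .CM6 a b _
  | CM7 a b x y => simpa only [GRS.sub, GRS.sub_ofConst] using .CM7 a b _ _
  | CF a b => simpa only [GRS.sub, GRS.sub_ofConst] using .CF a b
  | D1 a H h => simpa only [GRS.sub, GRS.sub_ofConst] using .D1 a H h

theorem Rewrites.sub (E : GRS Act γ) {i : ℕ} {t s : ACPTerm Act}
    (h : Rewrites γ E.rhs E.dom i t s) : ACPrDeriv γ (E.sub t) (E.sub s) := by
  induction h with
  | acp h => exact h.sub E
  | unfold h _ => simpa only [GRS.sub, if_pos h] using .RDP E _ h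
  | trans _ _ ih₁ ih₂ => exact .trans ih₁ ih₂
  | altCongr _ _ ih₁ ih₂ => exact .altCongr ih₁ ih₂
  | seqCongr _ _ ih₁ ih₂ => exact .seqCongr ih₁ ih₂
  | parCongr _ _ ih₁ ih₂ => exact .parCongr ih₁ ih₂
  | lmCongr _ _ ih₁ ih₂ => exact .lmCongr ih₁ ih₂
  | cmCongr _ _ ih₁ ih₂ => exact .cmCongr ih₁ ih₂
  | encapCongr H _ ih => exact .encapCongr H ih

end Lifting

/-! ### Head normal forms of closed ACPrec terms -/

section HeadNormalForms

variable {Act : Type} {γ : Option Act → Option Act → Option Act}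

/-- A closed ACPrec term is proper when each constant `⟨X|E⟩` in it refers to a
variable `X` that has an equation in `E`. -/
def ACPrTerm.Proper : ACPrTerm Act γ → Prop
  | .act _ => True
  | .delta => True
  | .var _ => False
  | .recur X E => X ∈ E.dom
  | .alt t s => t.Proper ∧ s.Proper
  | .seq t s => t.Proper ∧ s.Proper
  | .par t s => t.Proper ∧ s.Proper
  | .lm t s => t.Proper ∧ s.Proper
  | .cm t s => t.Proper ∧ s.Proper
  | .encap _ t => t.Proper

theorem GRS.proper_sub (E : GRS Act γ) {t : ACPTerm Act} (h : t.varsOf ⊆ E.dom) :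
    (E.sub t).Proper := by
  induction t with
  | act | delta => trivial
  | var X =>
    have hX : X ∈ E.dom := h rfl
    simpa only [GRS.sub, if_pos hX, ACPrTerm.Proper] using hX
  | alt _ _ ih₁ ih₂ | seq _ _ ih₁ ih₂ | par _ _ ih₁ ih₂ | lm _ _ ih₁ ih₂ | cm _ _ ih₁ ih₂ =>
    exact ⟨ih₁ (Set.subset_union_left.trans h), ih₂ (Set.subset_union_right.trans h)⟩
  | encap _ _ ih => exact ih h

/-- The term is derivably equal to a proper head normal form. -/
def ACPrTerm.HasHNF (t : ACPrTerm Act γ) : Prop :=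
  ∃ u : ACPrTerm Act γ, u.HNF ∧ u.Proper ∧ ACPrDeriv γ t u

namespace ACPrTerm.HasHNF

variable {t s : ACPrTerm Act γ}

theorem of_deriv (h : ACPrDeriv γ t s) (hs : s.HasHNF) : t.HasHNF :=
  let ⟨u, hu, hp, hd⟩ := hs
  ⟨u, hu, hp, h.trans hd⟩

theorem ofConst (a : Option Act) : (ACPrTerm.ofConst a : ACPrTerm Act γ).HasHNF := by
  cases a
  · exact ⟨.delta, .delta, trivial, .refl _⟩
  · exact ⟨.act _, .act _, trivial, .refl _⟩

theorem ofConst_seq (a : Option Act) (ht : t.Proper) :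
    (ACPrTerm.seq (.ofConst a) t).HasHNF := by
  cases a with
  | none => exact ⟨.delta, .delta, trivial, .A7 _⟩
  | some a => exact ⟨.seq (.act a) t, .seqAct a t, ⟨trivial, ht⟩, .refl _⟩

theorem alt (ht : t.HasHNF) (hs : s.HasHNF) : (ACPrTerm.alt t s).HasHNF :=
  let ⟨_, hu, hup, hud⟩ := ht
  let ⟨_, hv, hvp, hvd⟩ := hs
  ⟨_, .alt hu hv, ⟨hup, hvp⟩, .altCongr hud hvd⟩

theorem seq (ht : t.HasHNF) (hs : s.Proper) : (ACPrTerm.seq t s).HasHNF := by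
  obtain ⟨u, hu, hup, hud⟩ := ht
  refine of_deriv (.seqCongr hud (.refl s)) ?_
  clear hud
  induction hu with
  | delta => exact ofConst_seq none hs
  | act a => exact ofConst_seq (some a) hs
  | seqAct a x => exact of_deriv (.A5 _ _ _) (ofConst_seq (some a) ⟨hup.2, hs⟩)
  | alt _ _ ih₁ ih₂ => exact of_deriv (.A4 _ _ _) (alt (ih₁ hup.1) (ih₂ hup.2))

theorem lm (ht : t.HasHNF) (hs : s.Proper) : (ACPrTerm.lm t s).HasHNF := by
  obtain ⟨u, hu, hup, hud⟩ := ht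
  refine of_deriv (.lmCongr hud (.refl s)) ?_
  clear hud
  induction hu with
  | delta => exact of_deriv (.CM2 none _) (ofConst_seq none hs)
  | act a => exact of_deriv (.CM2 (some a) _) (ofConst_seq (some a) hs)
  | seqAct a x => exact of_deriv (.CM3 (some a) _ _) (ofConst_seq (some a) ⟨hup.2, hs⟩)
  | alt _ _ ih₁ ih₂ => exact of_deriv (.CM4 _ _ _) (alt (ih₁ hup.1) (ih₂ hup.2))

theorem encap (H : Set Act) (ht : t.HasHNF) : (ACPrTerm.encap H t).HasHNF := by
  have encap_act (a : Act) :
      ∃ c : Option Act, ACPrDeriv γ (.encap H (.act a)) (.ofConst c) := by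
    by_cases ha : a ∈ H
    · exact ⟨none, .D2 a H ha⟩
    · exact ⟨some a, .D1 (some a) H fun b hb => Option.some_injective _ hb ▸ ha⟩
  obtain ⟨u, hu, hup, hud⟩ := ht
  refine of_deriv (.encapCongr H hud) ?_
  clear hud
  induction hu with
  | delta => exact of_deriv (.D1 none H nofun) (ofConst none)
  | act a =>
    obtain ⟨c, hc⟩ := encap_act a
    exact of_deriv hc (ofConst c)
  | seqAct a x =>
    obtain ⟨c, hc⟩ := encap_act a
    exact of_deriv (.D4 _ _ _) (of_deriv (.seqCongr hc (.refl _)) (ofConst_seq c hup.2))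
  | alt _ _ ih₁ ih₂ => exact of_deriv (.D3 _ _ _) (alt (ih₁ hup.1) (ih₂ hup.2))

theorem cm_ofConst (a b : Option Act) :
    (ACPrTerm.cm (.ofConst a) (.ofConst b) : ACPrTerm Act γ).HasHNF :=
  of_deriv (.CF a b) (ofConst _)

theorem cm (ht : t.HasHNF) (hs : s.HasHNF) : (ACPrTerm.cm t s).HasHNF := by
  obtain ⟨u, hu, hup, hud⟩ := ht
  obtain ⟨v, hv, hvp, hvd⟩ := hs
  refine of_deriv (.cmCongr hud hvd) ?_
  clear hud hvd
  induction hu with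
  | alt _ _ ih₁ ih₂ => exact of_deriv (.CM8 _ _ _) (alt (ih₁ hup.1) (ih₂ hup.2))
  | delta =>
    induction hv with
    | alt _ _ ih₁ ih₂ => exact of_deriv (.CM9 _ _ _) (alt (ih₁ hvp.1) (ih₂ hvp.2))
    | delta => exact cm_ofConst none none
    | act b => exact cm_ofConst none (some b)
    | seqAct b y => exact of_deriv (.CM6 none (some b) y) (seq (cm_ofConst _ _) hvp.2)
  | act a =>
    induction hv with
    | alt _ _ ih₁ ih₂ => exact of_deriv (.CM9 _ _ _) (alt (ih₁ hvp.1) (ih₂ hvp.2))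
    | delta => exact cm_ofConst (some a) none
    | act b => exact cm_ofConst (some a) (some b)
    | seqAct b y => exact of_deriv (.CM6 (some a) (some b) y) (seq (cm_ofConst _ _) hvp.2)
  | seqAct a x =>
    induction hv with
    | alt _ _ ih₁ ih₂ => exact of_deriv (.CM9 _ _ _) (alt (ih₁ hvp.1) (ih₂ hvp.2))
    | delta => exact of_deriv (.CM5 (some a) none x) (seq (cm_ofConst _ _) hup.2)
    | act b => exact of_deriv (.CM5 (some a) (some b) x) (seq (cm_ofConst _ _) hup.2)
    | seqAct b y =>
      exact of_deriv (.CM7 (some a) (some b) x y) (seq (cm_ofConst _ _) ⟨hup.2, hvp.2⟩)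

theorem par (ht : t.HasHNF) (hs : s.HasHNF) (htp : t.Proper) (hsp : s.Proper) :
    (ACPrTerm.par t s).HasHNF :=
  of_deriv (.CM1 _ _) (alt (alt (lm ht hsp) (lm hs htp)) (cm ht hs))

end ACPrTerm.HasHNF

theorem GRS.hasHNF_sub (E : GRS Act γ) {t : ACPTerm Act} (hg : t.Guarded)
    (hv : t.varsOf ⊆ E.dom) : (E.sub t).HasHNF := by
  induction t with
  | act a => exact .ofConst (some a)
  | delta => exact .ofConst none
  | var X => exact hg.elim
  | encap H _ ih => exact .encap H (ih hg hv)
  | alt t s iht ihs =>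
    obtain ⟨ht, hs⟩ := Set.union_subset_iff.1 hv
    exact .alt (iht hg.1 ht) (ihs hg.2 hs)
  | seq t s iht _ =>
    obtain ⟨ht, hs⟩ := Set.union_subset_iff.1 hv
    rcases hg with ⟨a, rfl⟩ | hg
    · exact .ofConst_seq (some a) (E.proper_sub hs)
    · exact .seq (iht hg.1 ht) (E.proper_sub hs)
  | par t s iht ihs =>
    obtain ⟨ht, hs⟩ := Set.union_subset_iff.1 hv
    exact .par (iht hg.1 ht) (ihs hg.2 hs) (E.proper_sub ht) (E.proper_sub hs)
  | lm t s iht _ =>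
    obtain ⟨ht, hs⟩ := Set.union_subset_iff.1 hv
    exact .lm (iht hg.1 ht) (E.proper_sub hs)
  | cm t s iht ihs =>
    obtain ⟨ht, hs⟩ := Set.union_subset_iff.1 hv
    exact .cm (iht hg.1 ht) (ihs hg.2 hs)

theorem ACPrTerm.Proper.hasHNF {t : ACPrTerm Act γ} (h : t.Proper) : t.HasHNF := by
  induction t with
  | act a => exact .ofConst (some a)
  | delta => exact .ofConst none
  | var X => exact h.elim
  | recur X E =>
    obtain ⟨t', hr, hg, hv⟩ := E.guarded X h
    exact .of_deriv ((ACPrDeriv.RDP E X h).trans (hr.sub E)) (E.hasHNF_sub hg hv)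
  | alt t s iht ihs => exact .alt (iht h.1) (ihs h.2)
  | seq t s iht _ => exact .seq (iht h.1) h.2
  | par t s iht ihs => exact .par (iht h.1) (ihs h.2) h.1 h.2
  | lm t s iht _ => exact .lm (iht h.1) h.2
  | cm t s iht ihs => exact .cm (iht h.1) (ihs h.2)
  | encap H _ ih => exact .encap H (ih h)

end HeadNormalForms

/-! ### Linear specifications from head normal forms -/

section Linearization

variable {Act : Type} {γ : Option Act → Option Act → Option Act}

/-- The terms `t` for which a head normal form has a summand `a · t`. -/
def ACPrTerm.conts : ACPrTerm Act γ → Set (ACPrTerm Act γ)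
  | .alt t s => t.conts ∪ s.conts
  | .seq _ s => {s}
  | _ => ∅

theorem ACPrTerm.conts_finite (t : ACPrTerm Act γ) : t.conts.Finite := by
  induction t with
  | alt _ _ ih₁ ih₂ => exact ih₁.union ih₂
  | seq t s => exact Set.finite_singleton s
  | _ => exact Set.finite_empty

theorem ACPrTerm.Proper.of_mem_conts {t s : ACPrTerm Act γ} (h : t.Proper)
    (hs : s ∈ t.conts) : s.Proper := by
  induction t with
  | alt _ _ ih₁ ih₂ => exact hs.elim (ih₁ h.1) (ih₂ h.2)
  | seq t s' =>
    obtain rfl : s = s' := hs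
    exact h.2
  | _ => exact hs.elim

theorem ACPrTerm.HNF.exists_linear {u : ACPrTerm Act γ} (hu : u.HNF)
    {f : ℕ → ACPrTerm Act γ} (hf : u.conts ⊆ Set.range f) :
    ∃ l : ACPTerm Act, l.Linear ∧ (l.toACPr γ).subst f = u := by
  induction hu with
  | delta => exact ⟨.delta, .delta, rfl⟩
  | act a => exact ⟨.act a, .act a, rfl⟩
  | seqAct a t =>
    obtain ⟨n, rfl⟩ := hf rfl
    exact ⟨.seq (.act a) (.var n), .seqVar a n, rfl⟩
  | alt _ _ ih₁ ih₂ =>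
    obtain ⟨h₁, h₂⟩ := Set.union_subset_iff.1 hf
    obtain ⟨l₁, hl₁, rfl⟩ := ih₁ h₁
    obtain ⟨l₂, hl₂, rfl⟩ := ih₂ h₂
    exact ⟨.alt l₁ l₂, .alt hl₁ hl₂, rfl⟩

theorem ACPTerm.Linear.guarded {t : ACPTerm Act} (h : t.Linear) : t.Guarded := by
  induction h with
  | delta | act => trivial
  | seqVar a X => exact .inl ⟨a, rfl⟩
  | alt _ _ ih₁ ih₂ => exact ⟨ih₁, ih₂⟩

/-- The specification with the linear equations `n = l n` for all variables `n`. -/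
def GRS.ofLinear (γ : Option Act → Option Act → Option Act) (l : ℕ → ACPTerm Act)
    (hl : ∀ n, (l n).Linear) : GRS Act γ where
  dom := Set.univ
  rhs := l
  guarded n _ := ⟨l n, .acp (.refl _), (hl n).guarded, Set.subset_univ _⟩

end Linearization

theorem exists_countable_closed {α : Type*} (next : α → Set α)
    (hnext : ∀ x, (next x).Countable) (x : α) :
    ∃ S : Set α, S.Countable ∧ x ∈ S ∧ ∀ y ∈ S, next y ⊆ S := by
  let step : Set α → Set α := fun A => ⋃ a ∈ A, next a
  refine ⟨⋃ n, step^[n] {x}, Set.countable_iUnion fun n => ?_,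
    Set.mem_iUnion.2 ⟨0, rfl⟩, fun y hy z hz => ?_⟩
  · induction n with
    | zero => exact Set.countable_singleton x
    | succ n ih =>
      rw [Function.iterate_succ_apply']
      exact ih.biUnion fun a _ => hnext a
  · obtain ⟨n, hn⟩ := Set.mem_iUnion.1 hy
    refine Set.mem_iUnion.2 ⟨n + 1, ?_⟩
    rw [Function.iterate_succ_apply']
    exact Set.mem_biUnion hn hz

theorem exists_eq_range_apply_eq_of_countable {α : Type*} {S : Set α} (hS : S.Countable)
    {x : α} (hx : x ∈ S) (n : ℕ) : ∃ f : ℕ → α, S = Set.range f ∧ f n = x := by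
  obtain ⟨g, rfl⟩ := hS.exists_eq_range ⟨x, hx⟩
  obtain ⟨m, rfl⟩ := hx
  exact ⟨g ∘ Equiv.swap n m, ((Equiv.swap n m).surjective.range_comp g).symm, by simp⟩

/-- Reduction.
For each guarded recursive specification `E` over ACP and each variable `X`
occurring in `E`, there exists a finite or countably infinite linear recursive
specification `E'` over ACP such that `⟨X|E⟩ = ⟨X|E'⟩` is derivable from the
axioms of ACPrec in infinitary conditional equational logic. -/
theorem reduction_to_linear (Act : Type)
    (γ : Option Act → Option Act → Option Act)
    (hcomm : ∀ a b, γ a b = γ b a)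
    (hassoc : ∀ a b c, γ (γ a b) c = γ a (γ b c))
    (hdelta : ∀ a, γ none a = none)
    (E : GRS Act γ) (X : ℕ) (hX : X ∈ E.dom) :
    ∃ E' : GRS Act γ, E'.dom.Countable ∧ E'.Linear ∧ X ∈ E'.dom ∧
      ACPrDeriv γ (.recur X E) (.recur X E') := by
  have hnf (t : {t : ACPrTerm Act γ // t.Proper}) := t.2.hasHNF
  choose u hu hup hud using hnf
  obtain ⟨S, hS, hXS, hnext⟩ := exists_countable_closed
    (fun t => {s : {t : ACPrTerm Act γ // t.Proper} | s.1 ∈ (u t).conts})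
    (fun t => (u t).conts_finite.countable.preimage Subtype.val_injective) ⟨.recur X E, hX⟩
  obtain ⟨f, rfl, hfX⟩ := exists_eq_range_apply_eq_of_countable hS hXS X
  have hlin (n : ℕ) : ∃ l : ACPTerm Act, l.Linear ∧
      (l.toACPr γ).subst (fun k => (f k).1) = u (f n) := by
    refine (hu (f n)).exists_linear fun s hs => ?_
    obtain ⟨k, hk⟩ := hnext _ ⟨n, rfl⟩ (show (⟨s, (hup _).of_mem_conts hs⟩ :
      {t : ACPrTerm Act γ // t.Proper}) ∈ _ from hs)
    exact ⟨k, congrArg Subtype.val hk⟩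
  choose l hl hlu using hlin
  refine ⟨.ofLinear γ l hl, Set.to_countable _, fun n _ => hl n, trivial, ?_⟩
  have h := ACPrDeriv.RSP (.ofLinear γ l hl) (fun k => (f k).1)
    (fun n _ => (hlu n).symm ▸ hud (f n)) X trivial
  simpa only [hfX] using h

end ACPNote
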